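/- For every k ≥ 1, there exist infinitely many (pairwise non-isomorphic) connected graphs G with exactly k pendant vertices such that k ≥ χ(G) − 1 ≥ 1 and χ_la(G) = k + 1, where χ(G) is the chromatic number of G. -/

import Mathlib

open Finset
open scoped Classical

namespace LocalAntimagic

variable {V : Type*}

/-- The induced vertex label: sum of the labels of edges incident to `v`. -/
noncomputable def vertexSum [Fintype V] (G : SimpleGraph V) (f : Sym2 V → ℕ) (v : V) : ℕ :=
  ∑ e ∈ G.incidenceFinset v, f e

/-- `f` is a local antimagic labeling of `G`: a bijection from the edge set onto
`{1, …, |E|}` whose induced vertex labels distinguish adjacent vertices. -/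
def IsLocalAntimagic [Fintype V] (G : SimpleGraph V) (f : Sym2 V → ℕ) : Prop :=
  Set.BijOn f G.edgeSet (Set.Icc 1 G.edgeFinset.card) ∧
  ∀ ⦃u v : V⦄, G.Adj u v → vertexSum G f u ≠ vertexSum G f v

/-- The color number `c(f)`: the number of distinct induced vertex labels. -/
noncomputable def colorCount [Fintype V] (G : SimpleGraph V) (f : Sym2 V → ℕ) : ℕ :=
  (Finset.univ.image (vertexSum G f)).card

/-- The local antimagic chromatic number. -/
noncomputable def chiLA [Fintype V] (G : SimpleGraph V) : ℕ :=
  sInf {n | ∃ f, IsLocalAntimagic G f ∧ colorCount G f = n}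

/-- A pendant vertex is a vertex of degree 1. -/
def IsPendant [Fintype V] (G : SimpleGraph V) (v : V) : Prop :=
  G.degree v = 1

/-- The number of pendant vertices of `G`. -/
noncomputable def pendantCount [Fintype V] (G : SimpleGraph V) : ℕ :=
  (Finset.univ.filter (fun v => IsPendant G v)).card

section LowerBound

variable [Fintype V] {G : SimpleGraph V} {f : Sym2 V → ℕ}

lemma le_vertexSum {v : V} {e : Sym2 V} (he : e ∈ G.edgeSet) (hv : v ∈ e) :
    f e ≤ vertexSum G f v :=
  Finset.single_le_sum (f := f) (fun _ _ => Nat.zero_le _)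
    ((G.mem_incidenceFinset v e).2 ⟨he, hv⟩)

/-- The label of a pendant vertex is the label of its unique edge. -/
lemma IsPendant.exists_edge {v : V} (hv : IsPendant G v) :
    ∃ e ∈ G.edgeSet, v ∈ e ∧ vertexSum G f v = f e := by
  have hc : (G.incidenceFinset v).card = 1 := by
    rw [G.card_incidenceFinset_eq_degree]; exact hv
  obtain ⟨e, he⟩ := Finset.card_eq_one.1 hc
  have hm : e ∈ G.incidenceFinset v := by simp [he]
  rw [G.mem_incidenceFinset] at hm
  exact ⟨e, hm.1, hm.2, by simp [vertexSum, he]⟩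

lemma lt_vertexSum_of_not_isPendant {v : V} {e : Sym2 V}
    (hf : IsLocalAntimagic G f) (he : e ∈ G.edgeSet) (hv : v ∈ e) (hp : ¬ IsPendant G v) :
    f e < vertexSum G f v := by
  have hm : e ∈ G.incidenceFinset v := (G.mem_incidenceFinset v e).2 ⟨he, hv⟩
  have hc : (G.incidenceFinset v).card ≠ 1 := by
    rw [G.card_incidenceFinset_eq_degree]; exact hp
  have h1 : 1 < (G.incidenceFinset v).card := by
    have := Finset.card_pos.2 ⟨e, hm⟩
    omega
  obtain ⟨e', he', hne⟩ := Finset.exists_mem_ne h1 e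
  have hpos : 1 ≤ f e' :=
    (hf.1.mapsTo ((G.mem_incidenceFinset v e').1 he').1).1
  exact Finset.single_lt_sum hne hm he' hpos (fun _ _ _ => Nat.zero_le _)

/-- If no two pendant vertices are adjacent, then every local antimagic labeling uses more
colors than there are pendant vertices. -/
lemma pendantCount_lt_colorCount (hf : IsLocalAntimagic G f) (hne : G.edgeSet.Nonempty)
    (hG : ∀ ⦃u v⦄, G.Adj u v → IsPendant G u → ¬ IsPendant G v) :
    pendantCount G < colorCount G f := by
  set P : Finset V := Finset.univ.filter (fun v => IsPendant G v) with hP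
  have hinj : Set.InjOn (vertexSum G f) P := by
    intro u hu v hv huv
    have hu' : IsPendant G u := by simpa [hP] using hu
    have hv' : IsPendant G v := by simpa [hP] using hv
    obtain ⟨a, ha, hua, hsa⟩ := hu'.exists_edge (f := f)
    obtain ⟨b, hb, hvb, hsb⟩ := hv'.exists_edge (f := f)
    have hab : a = b := hf.1.injOn ha hb (by rw [← hsa, ← hsb, huv])
    subst hab
    by_contra huv'
    have : a = s(u, v) := (Sym2.mem_and_mem_iff huv').1 ⟨hua, hvb⟩
    subst this
    exact hG ha hu' hv'
  have hcard : (P.image (vertexSum G f)).card = P.card := Finset.card_image_of_injOn hinj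
  have hq : 1 ≤ G.edgeFinset.card := by
    obtain ⟨e, he⟩ := hne
    exact Finset.card_pos.2 ⟨e, G.mem_edgeFinset.2 he⟩
  obtain ⟨e, he, hfe⟩ := hf.1.surjOn ⟨hq, le_rfl⟩
  obtain ⟨w, hw, hwP⟩ : ∃ w ∈ e, ¬ IsPendant G w := by
    induction e with
    | _ x y =>
      by_cases hx : IsPendant G x
      · exact ⟨y, by simp, hG he hx⟩
      · exact ⟨x, by simp, hx⟩
  have hlt := lt_vertexSum_of_not_isPendant hf he hw hwP
  have hnot : vertexSum G f w ∉ P.image (vertexSum G f) := by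
    intro h
    obtain ⟨v, hv, hvw⟩ := Finset.mem_image.1 h
    have hv' : IsPendant G v := by simpa [hP] using hv
    obtain ⟨b, hb, _, hsb⟩ := hv'.exists_edge (f := f)
    have := (hf.1.mapsTo hb).2
    omega
  have hsub : insert (vertexSum G f w) (P.image (vertexSum G f)) ⊆
      Finset.univ.image (vertexSum G f) := by
    apply Finset.insert_subset
    · exact Finset.mem_image_of_mem _ (Finset.mem_univ _)
    · exact Finset.image_subset_image (Finset.subset_univ _)
  have := Finset.card_le_card hsub
  rw [Finset.card_insert_of_notMem hnot, hcard] at this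
  exact this

lemma chiLA_eq_pendantCount_add_one (hf : IsLocalAntimagic G f) (hne : G.edgeSet.Nonempty)
    (hG : ∀ ⦃u v⦄, G.Adj u v → IsPendant G u → ¬ IsPendant G v)
    (hc : colorCount G f ≤ pendantCount G + 1) :
    chiLA G = pendantCount G + 1 := by
  apply le_antisymm
  · exact le_trans (Nat.sInf_le (Set.mem_ofPred.2 ⟨f, hf, rfl⟩)) hc
  · refine le_csInf (Set.nonempty_of_mem (x := colorCount G f) ⟨f, hf, rfl⟩) ?_
    rintro _ ⟨g, hg, rfl⟩
    exact pendantCount_lt_colorCount hg hne hG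

end LowerBound

section EdgeFamily

variable {E : ℕ → Sym2 V} {q : ℕ}

/-- The graph whose edges are `E 1, …, E q`. -/
def familyGraph (E : ℕ → Sym2 V) (q : ℕ) : SimpleGraph V :=
  SimpleGraph.fromEdgeSet (E '' Set.Icc 1 q)

lemma edgeSet_familyGraph (hd : ∀ l ∈ Set.Icc 1 q, ¬ (E l).IsDiag) :
    (familyGraph E q).edgeSet = E '' Set.Icc 1 q := by
  rw [familyGraph, SimpleGraph.edgeSet_fromEdgeSet]
  ext e
  constructor
  · exact fun h => h.1
  · rintro ⟨l, hl, rfl⟩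
    exact ⟨⟨l, hl, rfl⟩, hd l hl⟩

lemma incidenceFinset_familyGraph (hd : ∀ l ∈ Set.Icc 1 q, ¬ (E l).IsDiag) (v : V)
    [Fintype V] [DecidablePred (v ∈ E ·)] :
    (familyGraph E q).incidenceFinset v = ((Finset.Icc 1 q).filter (v ∈ E ·)).image E := by
  ext e
  rw [SimpleGraph.mem_incidenceFinset, SimpleGraph.incidenceSet, edgeSet_familyGraph hd]
  simp only [Set.mem_image, Finset.mem_image, Finset.mem_filter,
    Finset.mem_Icc, Set.mem_Icc]
  constructor
  · rintro ⟨⟨l, hl, rfl⟩, hv⟩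
    exact ⟨l, ⟨hl, hv⟩, rfl⟩
  · rintro ⟨l, ⟨hl, hv⟩, rfl⟩
    exact ⟨⟨l, hl, rfl⟩, hv⟩

lemma degree_familyGraph (hi : Set.InjOn E (Set.Icc 1 q))
    (hd : ∀ l ∈ Set.Icc 1 q, ¬ (E l).IsDiag) (v : V)
    [Fintype V] [DecidablePred (v ∈ E ·)] :
    (familyGraph E q).degree v = ((Finset.Icc 1 q).filter (v ∈ E ·)).card := by
  rw [← SimpleGraph.card_incidenceFinset_eq_degree, incidenceFinset_familyGraph hd,
    Finset.card_image_of_injOn]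
  exact hi.mono (by intro l hl; simp at hl; exact hl.1)

/-- The labeling sending the edge `E l` to `l`. -/
noncomputable def familyLabel (E : ℕ → Sym2 V) (q : ℕ) : Sym2 V → ℕ :=
  Function.invFunOn E (Set.Icc 1 q)

lemma familyLabel_apply (hi : Set.InjOn E (Set.Icc 1 q)) {l : ℕ} (hl : l ∈ Set.Icc 1 q) :
    familyLabel E q (E l) = l :=
  hi.leftInvOn_invFunOn hl

lemma vertexSum_familyGraph (hi : Set.InjOn E (Set.Icc 1 q))
    (hd : ∀ l ∈ Set.Icc 1 q, ¬ (E l).IsDiag) (v : V)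
    [Fintype V] [DecidablePred (v ∈ E ·)] :
    vertexSum (familyGraph E q) (familyLabel E q) v =
      ∑ l ∈ (Finset.Icc 1 q).filter (v ∈ E ·), l := by
  rw [vertexSum, incidenceFinset_familyGraph hd, Finset.sum_image]
  · refine Finset.sum_congr rfl fun l hl => familyLabel_apply hi ?_
    simp at hl
    exact hl.1
  · exact hi.mono (by intro l hl; simp at hl; exact hl.1)

lemma bijOn_familyLabel [Fintype V] (hi : Set.InjOn E (Set.Icc 1 q))
    (hd : ∀ l ∈ Set.Icc 1 q, ¬ (E l).IsDiag) :
    Set.BijOn (familyLabel E q) (familyGraph E q).edgeSet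
      (Set.Icc 1 (familyGraph E q).edgeFinset.card) := by
  have hcard : (familyGraph E q).edgeFinset.card = q := by
    rw [← Set.ncard_coe_finset, SimpleGraph.coe_edgeFinset, edgeSet_familyGraph hd,
      hi.ncard_image, ← Finset.coe_Icc, Set.ncard_coe_finset]
    simp
  rw [hcard, edgeSet_familyGraph hd]
  refine ⟨?_, ?_, ?_⟩
  · rintro _ ⟨l, hl, rfl⟩
    rwa [familyLabel_apply hi hl]
  · rintro _ ⟨l, hl, rfl⟩ _ ⟨l', hl', rfl⟩ h
    rw [familyLabel_apply hi hl, familyLabel_apply hi hl'] at h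
    rw [h]
  · intro l hl
    exact ⟨E l, ⟨l, hl, rfl⟩, familyLabel_apply hi hl⟩

end EdgeFamily

section Balance

/-- Some choice of signs makes `± w 0 ± ⋯ ± w (n - 1)` equal to `c`. -/
def SignedSum (w : ℕ → ℤ) (n : ℕ) (c : ℤ) : Prop :=
  ∃ ε : ℕ → Bool, ∑ j ∈ Finset.range n, (if ε j then w j else - w j) = c

variable {w : ℕ → ℤ} {n : ℕ} {c : ℤ}

lemma SignedSum.succ (h : SignedSum w n c) (b : Bool) :
    SignedSum w (n + 1) (c + if b then w n else - w n) := by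
  obtain ⟨ε, hε⟩ := h
  refine ⟨fun j => if j = n then b else ε j, ?_⟩
  rw [Finset.sum_range_succ, ← hε]
  congr 1
  · refine Finset.sum_congr rfl fun j hj => ?_
    simp only [if_neg (Finset.mem_range.1 hj).ne]
  · simp

lemma SignedSum.add_four (h : SignedSum w n c)
    (hw : w n + w (n + 3) = w (n + 1) + w (n + 2)) : SignedSum w (n + 4) c := by
  have := (((h.succ true).succ false).succ false).succ true
  convert this using 1
  simp
  linarith

lemma SignedSum.add_four_mul (h : SignedSum w n c) (t : ℕ)
    (hw : ∀ i < t, w (n + 4 * i) + w (n + 4 * i + 3) = w (n + 4 * i + 1) + w (n + 4 * i + 2)) :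
    SignedSum w (n + 4 * t) c := by
  induction t with
  | zero => exact h
  | succ t ih =>
    exact (ih fun i hi => hw i (by omega)).add_four (hw t (by omega))

/-- The label difference on the `j`-th non-hub vertex: `2 j + 1` for `j ≤ m`, and
`m + 1 + j` afterwards. -/
def weight (m j : ℕ) : ℤ := ((m + 1 + j : ℕ) : ℤ) - ((m - j : ℕ) : ℤ)

lemma exists_signedSum_weight (k : ℕ) (hk : 1 ≤ k) (N : ℕ) :
    ∃ m, N ≤ m ∧ SignedSum (weight m) (m + k) 0 := by
  have h0 : ∀ w, SignedSum w 0 0 := fun w => ⟨fun _ => true, by simp⟩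
  have h1 : ∀ m, SignedSum (weight m) 1 1 := fun m => by
    have := (h0 (weight m)).succ true
    convert this using 1
    simp [weight]
  obtain ⟨i, hi⟩ : ∃ i, k = 4 * i + 1 ∨ k = 4 * i + 2 ∨ k = 4 * i + 3 ∨ k = 4 * i + 4 :=
    ⟨(k - 1) / 4, by omega⟩
  rcases hi with rfl | rfl | rfl | rfl
  · refine ⟨4 * N + 3, by omega, ?_⟩
    have h := (h0 (weight (4 * N + 3))).add_four_mul (N + 1)
      (by intro j hj; simp only [weight]; omega)
    have h := h.add_four_mul i (by intro j hj; simp only [weight]; omega)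
    convert h using 1
    ring
  · refine ⟨4 * N + 1, by omega, ?_⟩
    have h := (h1 (4 * N + 1)).add_four_mul N (by intro j hj; simp only [weight]; omega)
    have h := (h.succ true).succ false
    have h := h.add_four_mul i (by intro j hj; simp only [weight]; omega)
    convert h using 1
    · ring
    · simp only [weight, if_true, Bool.false_eq_true, if_false]; omega
  · refine ⟨4 * N, by omega, ?_⟩
    have h := (h1 (4 * N)).add_four_mul N (by intro j hj; simp only [weight]; omega)
    have h := (h.succ true).succ false
    have h := h.add_four_mul i (by intro j hj; simp only [weight]; omega)
    convert h using 1
    · ring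
    · simp only [weight, if_true, Bool.false_eq_true, if_false]; omega
  · refine ⟨4 * N, by omega, ?_⟩
    have h := (h0 (weight (4 * N))).add_four_mul N
      (by intro j hj; simp only [weight]; omega)
    have h := h.add_four_mul (i + 1) (by intro j hj; simp only [weight]; omega)
    convert h using 1
    ring

end Balance

section Construction

variable {m k : ℕ} {ε : ℕ → Bool}

/-- The hub (`0` or `1`) at which the edge labeled `l` ends. -/
def hub (m : ℕ) (ε : ℕ → Bool) (l : ℕ) : ℕ :=
  if m < l then (if ε (l - m - 1) then 0 else 1) else (if ε (m - l) then 1 else 0)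

/-- The index of the non-hub vertex at which the edge labeled `l` ends. -/
def spoke (m l : ℕ) : ℕ := if m < l then l - m - 1 else m - l

lemma hub_lt_two (l : ℕ) : hub m ε l < 2 := by
  unfold hub; split_ifs <;> omega

lemma spoke_lt {l : ℕ} (hl : l ∈ Set.Icc 1 (2 * m + k)) : spoke m l < m + k := by
  obtain ⟨h1, h2⟩ := hl
  unfold spoke; split_ifs <;> omega

/-- The edge labeled `l`. Vertices `0` and `1` are the hubs, `j + 2` is joined to both hubs
for `j < m` and to one of them for `m ≤ j < m + k`. -/
def hubEdge (m k : ℕ) (ε : ℕ → Bool) (l : ℕ) : Sym2 (Fin (m + k + 2)) :=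
  s(Fin.ofNat _ (hub m ε l), Fin.ofNat _ (spoke m l + 2))

lemma mem_hubEdge {l : ℕ} (hl : l ∈ Set.Icc 1 (2 * m + k)) (v : Fin (m + k + 2)) :
    v ∈ hubEdge m k ε l ↔ v.val = hub m ε l ∨ v.val = spoke m l + 2 := by
  have h1 : hub m ε l < m + k + 2 := by have := hub_lt_two (m := m) (ε := ε) l; omega
  have h2 : spoke m l + 2 < m + k + 2 := by have := spoke_lt hl; omega
  simp [hubEdge, Fin.ext_iff, Nat.mod_eq_of_lt h1, Nat.mod_eq_of_lt h2]

lemma not_isDiag_hubEdge : ∀ l ∈ Set.Icc 1 (2 * m + k), ¬ (hubEdge m k ε l).IsDiag := by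
  intro l hl
  have h0 := hub_lt_two (m := m) (ε := ε) l
  have h1 : hub m ε l < m + k + 2 := by omega
  have h2 : spoke m l + 2 < m + k + 2 := by have := spoke_lt hl; omega
  simp [hubEdge, Fin.ext_iff, Nat.mod_eq_of_lt h1, Nat.mod_eq_of_lt h2]
  omega

lemma injOn_hubEdge : Set.InjOn (hubEdge m k ε) (Set.Icc 1 (2 * m + k)) := by
  intro a ha b hb hab
  have h0 := hub_lt_two (m := m) (ε := ε) a
  have h0' := hub_lt_two (m := m) (ε := ε) b
  have hs := spoke_lt ha
  have key : ∀ v, v ∈ hubEdge m k ε a ↔ v ∈ hubEdge m k ε b := fun v => by rw [hab]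
  simp only [mem_hubEdge ha, mem_hubEdge hb] at key
  have k1 := key ⟨hub m ε a, by omega⟩
  have k2 := key ⟨spoke m a + 2, by omega⟩
  simp at k1 k2
  have e1 : hub m ε a = hub m ε b := by omega
  have e2 : spoke m a = spoke m b := by omega
  obtain ⟨ha1, -⟩ := ha
  obtain ⟨hb1, -⟩ := hb
  unfold spoke at e2
  unfold hub at e1
  by_cases h : m < a <;> by_cases h' : m < b <;> simp only [h, h', if_true, if_false] at e1 e2
  · omega
  · rw [e2] at e1; split_ifs at e1
  · rw [e2] at e1; split_ifs at e1
  · omega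

/-- Two hubs joined by `m` paths of length two, with `k` pendant vertices attached to them. -/
abbrev hubGraph (m k : ℕ) (ε : ℕ → Bool) : SimpleGraph (Fin (m + k + 2)) :=
  familyGraph (hubEdge m k ε) (2 * m + k)

/-- The labeling sending `hubEdge m k ε l` to `l`. -/
noncomputable abbrev hubLabel (m k : ℕ) (ε : ℕ → Bool) : Sym2 (Fin (m + k + 2)) → ℕ :=
  familyLabel (hubEdge m k ε) (2 * m + k)

lemma filter_mem_hubEdge_spoke {v : Fin (m + k + 2)} (hv : 2 ≤ v.val) :
    (Finset.Icc 1 (2 * m + k)).filter (v ∈ hubEdge m k ε ·) =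
      if v.val < m + 2 then {m + v.val - 1, m + 2 - v.val} else {m + v.val - 1} := by
  have hvlt := v.isLt
  ext l
  rw [Finset.mem_filter, Finset.mem_Icc]
  have : (1 ≤ l ∧ l ≤ 2 * m + k) ∧ v ∈ hubEdge m k ε l ↔
      (1 ≤ l ∧ l ≤ 2 * m + k) ∧ v.val = spoke m l + 2 := by
    refine and_congr_right fun hl => ?_
    rw [mem_hubEdge hl]
    have := hub_lt_two (m := m) (ε := ε) l
    omega
  rw [this]
  unfold spoke
  split_ifs <;> simp <;> omega

lemma vertexSum_spoke {v : Fin (m + k + 2)} (hv : 2 ≤ v.val) :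
    vertexSum (hubGraph m k ε) (hubLabel m k ε) v = (m + v.val - 1) + (m + 2 - v.val) := by
  rw [vertexSum_familyGraph injOn_hubEdge not_isDiag_hubEdge, filter_mem_hubEdge_spoke hv]
  split_ifs with h
  · rw [Finset.sum_pair (by omega)]
  · simp; omega

lemma isPendant_spoke_iff {v : Fin (m + k + 2)} (hv : 2 ≤ v.val) :
    IsPendant (hubGraph m k ε) v ↔ m + 2 ≤ v.val := by
  rw [IsPendant, degree_familyGraph injOn_hubEdge not_isDiag_hubEdge,
    filter_mem_hubEdge_spoke hv]
  split_ifs with h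
  · rw [Finset.card_pair (by omega)]; omega
  · simp; omega

lemma sum_Icc_eq (m k : ℕ) (g : ℕ → ℕ) (hg : g 0 = 0) :
    ∑ l ∈ Finset.Icc 1 (2 * m + k), g l =
      ∑ j ∈ Finset.range (m + k), (g (m + 1 + j) + g (m - j)) := by
  have h1 : ∑ l ∈ Finset.Icc 1 (2 * m + k), g l = ∑ l ∈ Finset.range (m + 1 + (m + k)), g l := by
    refine Finset.sum_subset (fun l hl => ?_) (fun l hl hl' => ?_)
    · simp at hl ⊢; omega
    · simp at hl hl'
      obtain rfl : l = 0 := by omega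
      exact hg
  have h2 : ∑ j ∈ Finset.range (m + k), g (m - j) = ∑ l ∈ Finset.range (m + 1), g l := by
    have : ∑ j ∈ Finset.range (m + 1 + k), g (m - j) = ∑ l ∈ Finset.range (m + 1), g l := by
      rw [Finset.sum_range_add, ← Finset.sum_range_reflect g (m + 1)]
      simp only [show ∀ x, m - (m + 1 + x) = 0 by omega, hg, Finset.sum_const_zero, add_zero]
      rfl
    rw [← this, show m + 1 + k = m + k + 1 by ring, Finset.sum_range_succ]
    simp [hg]
  rw [h1, Finset.sum_range_add, Finset.sum_add_distrib, h2, add_comm]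

lemma vertexSum_hub {v : Fin (m + k + 2)} (hv : v.val < 2) :
    vertexSum (hubGraph m k ε) (hubLabel m k ε) v =
      ∑ j ∈ Finset.range (m + k),
        if (v.val = if ε j then 0 else 1) then m + 1 + j else m - j := by
  have : ∑ l ∈ (Finset.Icc 1 (2 * m + k)).filter (v ∈ hubEdge m k ε ·), l =
      ∑ l ∈ Finset.Icc 1 (2 * m + k), if v.val = hub m ε l then l else 0 := by
    rw [Finset.sum_filter]
    refine Finset.sum_congr rfl fun l hl => ?_
    have : v ∈ hubEdge m k ε l ↔ v.val = hub m ε l := by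
      rw [mem_hubEdge (by simpa using hl)]; omega
    simp [this]
  rw [vertexSum_familyGraph injOn_hubEdge not_isDiag_hubEdge, this, sum_Icc_eq _ _ _ (by simp)]
  refine Finset.sum_congr rfl fun j hj => ?_
  have e1 : hub m ε (m + 1 + j) = if ε j then 0 else 1 := by
    rw [hub, if_pos (by omega), show m + 1 + j - m - 1 = j by omega]
  rw [e1]
  by_cases hjm : j ≤ m
  · have e2 : hub m ε (m - j) = if ε j then 1 else 0 := by
      rw [hub, if_neg (by omega), show m - (m - j) = j by omega]
    rw [e2]
    obtain h | h : v.val = 0 ∨ v.val = 1 := by omega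
    all_goals cases ε j <;> simp [h]
  · rw [show m - j = 0 by omega]
    simp

lemma vertexSum_hub_eq (hε : ∑ j ∈ Finset.range (m + k),
      (if ε j then weight m j else - weight m j) = 0) :
    vertexSum (hubGraph m k ε) (hubLabel m k ε) 0 =
      vertexSum (hubGraph m k ε) (hubLabel m k ε) 1 := by
  rw [vertexSum_hub (by simp), vertexSum_hub (by simp)]
  zify
  rw [← sub_eq_zero, ← Finset.sum_sub_distrib]
  refine Eq.trans ?_ hε
  refine Finset.sum_congr rfl fun j _ => ?_
  cases ε j <;> simp [weight]

lemma vertexSum_hub_add :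
    vertexSum (hubGraph m k ε) (hubLabel m k ε) 0 +
      vertexSum (hubGraph m k ε) (hubLabel m k ε) 1 = ∑ l ∈ Finset.Icc 1 (2 * m + k), l := by
  rw [vertexSum_hub (by simp), vertexSum_hub (by simp), sum_Icc_eq _ _ _ rfl,
    ← Finset.sum_add_distrib]
  refine Finset.sum_congr rfl fun j _ => ?_
  cases ε j <;> simp
  omega

lemma lt_vertexSum_hub (hm : 2 ≤ m) (hε : ∑ j ∈ Finset.range (m + k),
      (if ε j then weight m j else - weight m j) = 0) {v : Fin (m + k + 2)} (hv : v.val < 2) :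
    2 * m + k < vertexSum (hubGraph m k ε) (hubLabel m k ε) v := by
  have h1 := vertexSum_hub_eq hε
  have h2 := vertexSum_hub_add (m := m) (k := k) (ε := ε)
  have h3 : (∑ l ∈ Finset.Icc 1 (2 * m + k), l) * 2 = (2 * m + k + 1) * (2 * m + k) := by
    refine Eq.trans ?_ (Finset.sum_range_id_mul_two (2 * m + k + 1))
    congr 1
    refine Finset.sum_subset (fun l hl => ?_) (fun l hl hl' => ?_)
    · simp at hl ⊢; omega
    · simp at hl hl'; omega
  have h4 : 2 * m + k < vertexSum (hubGraph m k ε) (hubLabel m k ε) 0 := by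
    nlinarith
  obtain h | h : v.val = 0 ∨ v.val = 1 := by omega
  · rwa [show v = 0 from Fin.ext h]
  · rwa [show v = 1 from Fin.ext (by simpa using h), ← h1]

lemma hubGraph_adj_lt {u v : Fin (m + k + 2)} (h : (hubGraph m k ε).Adj u v) :
    (u.val < 2 ∧ 2 ≤ v.val) ∨ (v.val < 2 ∧ 2 ≤ u.val) := by
  have h' : s(u, v) ∈ (hubGraph m k ε).edgeSet := h
  rw [edgeSet_familyGraph not_isDiag_hubEdge] at h'
  obtain ⟨l, hl, he⟩ := h'
  have hu : u ∈ hubEdge m k ε l := by simp [he]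
  have hv : v ∈ hubEdge m k ε l := by simp [he]
  rw [mem_hubEdge hl] at hu hv
  have h0 := hub_lt_two (m := m) (ε := ε) l
  have hne : u.val ≠ v.val := fun hh => h.ne (Fin.ext hh)
  omega

lemma hubGraph_adj {l : ℕ} (hl : l ∈ Set.Icc 1 (2 * m + k)) {u v : Fin (m + k + 2)}
    (hu : u.val = hub m ε l) (hv : v.val = spoke m l + 2) : (hubGraph m k ε).Adj u v := by
  have h0 := hub_lt_two (m := m) (ε := ε) l
  have hne : u ≠ v := by rintro rfl; omega
  change s(u, v) ∈ (hubGraph m k ε).edgeSet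
  rw [edgeSet_familyGraph not_isDiag_hubEdge]
  exact ⟨l, hl, (Sym2.mem_and_mem_iff hne).1
    ⟨(mem_hubEdge hl u).2 (.inl hu), (mem_hubEdge hl v).2 (.inr hv)⟩⟩

lemma hubGraph_adj_middle {u v : Fin (m + k + 2)} (hu : u.val < 2) (hv : 2 ≤ v.val)
    (hv' : v.val < m + 2) : (hubGraph m k ε).Adj u v := by
  have hl : m + v.val - 1 ∈ Set.Icc 1 (2 * m + k) := ⟨by omega, by omega⟩
  have hl' : m + 2 - v.val ∈ Set.Icc 1 (2 * m + k) := ⟨by omega, by omega⟩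
  have e : hub m ε (m + v.val - 1) = if ε (v.val - 2) then 0 else 1 := by
    rw [hub, if_pos (by omega), show m + v.val - 1 - m - 1 = v.val - 2 by omega]
  have e' : hub m ε (m + 2 - v.val) = if ε (v.val - 2) then 1 else 0 := by
    rw [hub, if_neg (by omega), show m - (m + 2 - v.val) = v.val - 2 by omega]
  by_cases h : u.val = hub m ε (m + v.val - 1)
  · exact hubGraph_adj hl h (by unfold spoke; split_ifs <;> omega)
  · refine hubGraph_adj hl' ?_ (by unfold spoke; split_ifs <;> omega)
    rw [e] at h
    rw [e']
    split_ifs at h ⊢ <;> omega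

lemma exists_hub_adj {v : Fin (m + k + 2)} (hv : 2 ≤ v.val) :
    ∃ u : Fin (m + k + 2), u.val < 2 ∧ (hubGraph m k ε).Adj u v := by
  have hl : m + v.val - 1 ∈ Set.Icc 1 (2 * m + k) := ⟨by omega, by omega⟩
  have h0 := hub_lt_two (m := m) (ε := ε) (m + v.val - 1)
  exact ⟨⟨hub m ε (m + v.val - 1), by omega⟩, h0,
    hubGraph_adj hl rfl (by unfold spoke; split_ifs <;> omega)⟩

lemma hubGraph_connected (hm : 1 ≤ m) : (hubGraph m k ε).Connected := by
  have hmid : ∀ u : Fin (m + k + 2), u.val < 2 →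
      (hubGraph m k ε).Reachable u ⟨2, by omega⟩ := fun u hu =>
    (hubGraph_adj_middle hu le_rfl (by simp; omega)).reachable
  have hall : ∀ u : Fin (m + k + 2), (hubGraph m k ε).Reachable u ⟨2, by omega⟩ := by
    intro u
    by_cases hu : u.val < 2
    · exact hmid u hu
    · obtain ⟨x, hx, hxu⟩ := exists_hub_adj (ε := ε) (not_lt.1 hu)
      exact hxu.symm.reachable.trans (hmid x hx)
  exact ⟨fun u v => (hall u).trans (hall v).symm⟩

lemma isLocalAntimagic_hubLabel (hm : 2 ≤ m) (hk : 1 ≤ k)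
    (hε : ∑ j ∈ Finset.range (m + k), (if ε j then weight m j else - weight m j) = 0) :
    IsLocalAntimagic (hubGraph m k ε) (hubLabel m k ε) := by
  refine ⟨bijOn_familyLabel injOn_hubEdge not_isDiag_hubEdge, fun u v huv => ?_⟩
  have hu := u.isLt
  have hv := v.isLt
  rcases hubGraph_adj_lt huv with ⟨h, h'⟩ | ⟨h, h'⟩
  · have := lt_vertexSum_hub hm hε h
    rw [vertexSum_spoke h']
    omega
  · have := lt_vertexSum_hub hm hε h
    rw [vertexSum_spoke h']
    omega

lemma not_isPendant_hub (hm : 2 ≤ m) {v : Fin (m + k + 2)} (hv : v.val < 2) :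
    ¬ IsPendant (hubGraph m k ε) v := by
  have a := (hubGraph_adj_middle (m := m) (k := k) (ε := ε) hv
    (v := ⟨2, by omega⟩) le_rfl (by simp; omega))
  have b := (hubGraph_adj_middle (m := m) (k := k) (ε := ε) hv
    (v := ⟨3, by omega⟩) (by simp) (by simp; omega))
  intro h
  rw [IsPendant, SimpleGraph.degree_eq_one_iff_existsUnique_adj] at h
  simpa using h.unique a b

lemma pendantCount_hubGraph (hm : 2 ≤ m) : pendantCount (hubGraph m k ε) = k := by
  have : Finset.univ.filter (fun v => IsPendant (hubGraph m k ε) v) =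
      (Finset.univ : Finset (Fin k)).map
        ((Fin.natAddEmb (m + 2)).trans (finCongr (by omega)).toEmbedding) := by
    ext v
    simp only [Finset.mem_filter, Finset.mem_univ, true_and, Finset.mem_map]
    constructor
    · intro h
      have hv : 2 ≤ v.val := by
        by_contra hlt
        exact not_isPendant_hub hm (not_le.1 hlt) h
      rw [isPendant_spoke_iff hv] at h
      exact ⟨⟨v.val - (m + 2), by omega⟩, Fin.ext (by simp; omega)⟩
    · rintro ⟨i, rfl⟩
      rw [isPendant_spoke_iff (by simp; omega)]
      simp
  rw [pendantCount, this]
  simp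

lemma colorCount_hubLabel_le (hk : 1 ≤ k)
    (hε : ∑ j ∈ Finset.range (m + k), (if ε j then weight m j else - weight m j) = 0) :
    colorCount (hubGraph m k ε) (hubLabel m k ε) ≤ k + 1 := by
  have hsub : Finset.univ.image (vertexSum (hubGraph m k ε) (hubLabel m k ε)) ⊆
      insert (vertexSum (hubGraph m k ε) (hubLabel m k ε) 0)
        (Finset.Icc (2 * m + 1) (2 * m + k)) := by
    intro c hc
    obtain ⟨v, -, rfl⟩ := Finset.mem_image.1 hc
    have hv := v.isLt
    rw [Finset.mem_insert, Finset.mem_Icc]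
    by_cases h : 2 ≤ v.val
    · right
      rw [vertexSum_spoke h]
      omega
    · left
      obtain h | h : v.val = 0 ∨ v.val = 1 := by omega
      · rw [show v = 0 from Fin.ext h]
      · rw [show v = 1 from Fin.ext (by simpa using h), vertexSum_hub_eq hε]
  refine (Finset.card_le_card hsub).trans ((Finset.card_insert_le _ _).trans ?_)
  simp

lemma hubGraph_colorable : (hubGraph m k ε).Colorable 2 := by
  refine ⟨SimpleGraph.Coloring.mk (fun v => if v.val < 2 then 0 else 1) fun {u v} h => ?_⟩
  rcases hubGraph_adj_lt h with ⟨h, h'⟩ | ⟨h, h'⟩ <;> simp [h, not_lt.2 h']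

end Construction

/-- for every `k ≥ 1` there exist infinitely many (pairwise
non-isomorphic, here realized by arbitrarily large vertex counts) connected graphs `G`
with exactly `k` pendant vertices, `k ≥ χ(G) - 1 ≥ 1` (i.e. `2 ≤ χ(G) ≤ k + 1`) and
`χ_la(G) = k + 1`. -/
theorem exists_infinitely_many_chiLA_eq_pendant_add_one (k : ℕ) (hk : 1 ≤ k) :
    ∀ N : ℕ, ∃ (m : ℕ) (G : SimpleGraph (Fin m)),
      N ≤ m ∧ G.Connected ∧ pendantCount G = k ∧
      2 ≤ G.chromaticNumber ∧ G.chromaticNumber ≤ (k + 1 : ℕ) ∧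
      chiLA G = k + 1 := by
  intro N
  obtain ⟨m, hm, ε, hε⟩ := exists_signedSum_weight k hk (N + 2)
  have hadj : (hubGraph m k ε).Adj 0 ⟨2, by omega⟩ :=
    hubGraph_adj_middle (by simp) le_rfl (by simp; omega)
  have hP := pendantCount_hubGraph (m := m) (k := k) (ε := ε) (by omega)
  refine ⟨m + k + 2, hubGraph m k ε, by omega, hubGraph_connected (by omega), hP,
    SimpleGraph.two_le_chromaticNumber_of_adj hadj, ?_, ?_⟩
  · refine hubGraph_colorable.chromaticNumber_le.trans ?_
    exact_mod_cast Nat.succ_le_succ hk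
  · rw [chiLA_eq_pendantCount_add_one (isLocalAntimagic_hubLabel (by omega) hk hε)
      ⟨s(0, ⟨2, by omega⟩), hadj⟩
      ?_ (by rw [hP]; exact colorCount_hubLabel_le hk hε), hP]
    intro u v huv hu hv
    rcases hubGraph_adj_lt huv with ⟨h, -⟩ | ⟨h, -⟩
    · exact not_isPendant_hub (by omega) h hu
    · exact not_isPendant_hub (by omega) h hv

end LocalAntimagic
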